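/- Let d be a positive even integer, A a Γ-equivalence class in F_d, and x an irrational real number. Then the map (P, γ) ↦ P|γ from the set {(P, γ) ∈ A^Sim × Γ(x) : P(γ(∞)) < 0 < P(γ(x))} to A⟨x⟩ is surjective (but in general not injective). -/

import Mathlib

open Polynomial Matrix

noncomputable section

abbrev Mat2 := Matrix (Fin 2) (Fin 2) ℤ

/-- The matrix `Tⁿ = [[1,n],[0,1]]`. -/
def Tpow (n : ℤ) : Mat2 := !![1, n; 0, 1]

/-- The matrix `ε = [[0,1],[1,0]]`. -/
def Meps : Mat2 := !![0, 1; 1, 0]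

/-- The matrix `S = [[0,-1],[1,0]]`. -/
def MS : Mat2 := !![0, -1; 1, 0]

/-- The matrix `T = [[1,1],[0,1]]`. -/
def MT : Mat2 := !![1, 1; 0, 1]

/-- The matrix `σ = [[-1,0],[0,1]]`. -/
def Msig : Mat2 := !![-1, 0; 0, 1]

/-- The matrix `U = TS = [[1,-1],[1,0]]`. -/
def MU : Mat2 := MT * MS

/-- Möbius action of an integer matrix on a real number. -/
def moeb (M : Mat2) (x : ℝ) : ℝ :=
  ((M 0 0 : ℝ) * x + (M 0 1 : ℝ)) / ((M 1 0 : ℝ) * x + (M 1 1 : ℝ))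

/-- The sequence `x_i` of the (positive) continued fraction algorithm:
`x_0 = x`, `x_{i+1} = 1/(x_i - ⌊x_i⌋)`. -/
def cfX (x : ℝ) : ℕ → ℝ
  | 0 => x
  | i + 1 => 1 / (cfX x i - (⌊cfX x i⌋ : ℝ))

/-- The partial quotients `n_i = ⌊x_i⌋` of the continued fraction of `x`. -/
def cfN (x : ℝ) (i : ℕ) : ℤ := ⌊cfX x i⌋

/-- The matrices `γ_0 = Id`, `γ_{i+1} = ε T^{-n_i} γ_i`. -/
def gam (x : ℝ) : ℕ → Mat2
  | 0 => 1
  | i + 1 => (Meps * Tpow (-(cfN x i))) * gam x i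

/-- `Γ(x) = {γ_1, γ_2, γ_3, …}`. -/
def GammaSet (x : ℝ) : Set Mat2 := {M | ∃ i, 1 ≤ i ∧ M = gam x i}

/-- The matrices `γ'_0 = Id`, `γ'_{i+1} = Tγ'_i` if `γ'_i(x) ≤ 0`,
`T^{-1}εγ'_i` if `0 < γ'_i(x) ≤ 1`, and `T^{-1}γ'_i` if `γ'_i(x) > 1`. -/
def gam' (x : ℝ) : ℕ → Mat2
  | 0 => 1
  | i + 1 =>
    if moeb (gam' x i) x ≤ 0 then MT * gam' x i
    else if moeb (gam' x i) x ≤ 1 then (Tpow (-1) * Meps) * gam' x i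
    else Tpow (-1) * gam' x i

/-- `Γ(x)' = {γ'_1, γ'_2, γ'_3, …}`. -/
def GammaSet' (x : ℝ) : Set Mat2 := {M | ∃ i, 1 ≤ i ∧ M = gam' x i}

/-- The sequence `x_i` of the negative continued fraction algorithm:
`x_0 = x`, `x_{i+1} = 1/(⌈x_i⌉ - x_i)`. -/
def ncfX (x : ℝ) : ℕ → ℝ
  | 0 => x
  | i + 1 => 1 / ((⌈ncfX x i⌉ : ℝ) - ncfX x i)

/-- The partial quotients `m_i = ⌈x_i⌉` of the negative continued fraction of `x`. -/
def ncfM (x : ℝ) (i : ℕ) : ℤ := ⌈ncfX x i⌉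

/-- The matrices `γ̃_0 = Id`, `γ̃_{i+1} = S T^{-m_i} γ̃_i`. -/
def gamt (x : ℝ) : ℕ → Mat2
  | 0 => 1
  | i + 1 => (MS * Tpow (-(ncfM x i))) * gamt x i

/-- `Γ₁(x) = {γ̃_1, γ̃_2, γ̃_3, …}`. -/
def Gamma1Set (x : ℝ) : Set Mat2 := {M | ∃ i, 1 ≤ i ∧ M = gamt x i}

/-- A binary quadratic polynomial `aX² + bX + c`, encoded as the triple `(a,b,c)`. -/
abbrev QF := ℤ × ℤ × ℤ

/-- The value of `aX² + bX + c` at a real number `x`. -/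
def Qval (q : QF) (x : ℝ) : ℝ := (q.1 : ℝ) * x ^ 2 + (q.2.1 : ℝ) * x + (q.2.2 : ℝ)

/-- The value of `aX² + bX + c` at an integer `m`. -/
def QvalZ (q : QF) (m : ℤ) : ℤ := q.1 * m ^ 2 + q.2.1 * m + q.2.2

/-- The discriminant `b² - 4ac`. -/
def Qdisc (q : QF) : ℤ := q.2.1 ^ 2 - 4 * q.1 * q.2.2

/-- The homogenized value `a r² + b r t + c t²`; for `t ≠ 0` its sign is that of `Q(r/t)`,
and for `t = 0` that of the leading coefficient, i.e. of `Q(∞)`. -/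
def Qhom (q : QF) (r t : ℤ) : ℤ := q.1 * r ^ 2 + q.2.1 * r * t + q.2.2 * t ^ 2

/-- The weight 2 action `(Q|γ)(X) = (tX+u)² Q((rX+s)/(tX+u))` on quadratic polynomials,
for `γ = [[r,s],[t,u]]`. -/
def qslash (M : Mat2) (q : QF) : QF :=
  (Qhom q (M 0 0) (M 1 0),
   2 * q.1 * M 0 0 * M 0 1 + q.2.1 * (M 0 0 * M 1 1 + M 0 1 * M 1 0) + 2 * q.2.2 * M 1 0 * M 1 1,
   Qhom q (M 0 1) (M 1 1))

/-- The set `𝒬` of integral quadratic polynomials with positive non-square discriminant. -/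
def Qset : Set QF := {q | 0 < Qdisc q ∧ ¬ IsSquare (Qdisc q)}

/-- `A` is a `Γ`-equivalence class in `𝒬`, where `Γ = PGL₂(ℤ)`. -/
def IsClassQ (A : Set QF) : Prop :=
  ∃ q₀ ∈ Qset, A = {q ∈ Qset | ∃ M : Mat2, IsUnit M.det ∧ q = qslash M q₀}

/-- `B` is a `Γ₁`-equivalence class in `𝒬`, where `Γ₁ = PSL₂(ℤ)`. -/
def IsClassQ1 (B : Set QF) : Prop :=
  ∃ q₀ ∈ Qset, B = {q ∈ Qset | ∃ M : Mat2, M.det = 1 ∧ q = qslash M q₀}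

/-- `A^Sim = {Q ∈ A : Q(0) < 0 < Q(∞)}`. -/
def QSim (A : Set QF) : Set QF := {q ∈ A | q.2.2 < 0 ∧ 0 < q.1}

/-- `A^Red = {Q ∈ A : Q(∞) > 0, Q(-1) < 0 < Q(0)}`. -/
def QRed (A : Set QF) : Set QF := {q ∈ A | 0 < q.1 ∧ q.1 - q.2.1 + q.2.2 < 0 ∧ 0 < q.2.2}

/-- `A⟨x⟩ = {Q ∈ A : Q(∞) < 0 < Q(x)}`. -/
def QxSet (A : Set QF) (x : ℝ) : Set QF := {q ∈ A | q.1 < 0 ∧ 0 < Qval q x}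

/-- `𝒬_D⟨x⟩`, the set of quadratics of discriminant `D` with `Q(∞) < 0 < Q(x)`. -/
def QDx (D : ℕ) (x : ℝ) : Set QF :=
  {q | Qdisc q = (D : ℤ) ∧ q.1 < 0 ∧ 0 < Qval q x}

/-- The simple forms of discriminant `D`: `a > 0 > c`. -/
def SimpleD (D : ℕ) : Set QF := {q | Qdisc q = (D : ℤ) ∧ 0 < q.1 ∧ q.2.2 < 0}

/-- The reduced forms of discriminant `D`: `a > 0`, `c > 0`, `b > a + c`. -/
def ReducedD (D : ℕ) : Set QF :=
  {q | Qdisc q = (D : ℤ) ∧ 0 < q.1 ∧ 0 < q.2.2 ∧ q.1 + q.2.2 < q.2.1}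

/-- Homogenized evaluation of a polynomial of degree ≤ d: `∑ P_j r^j t^{d-j}`;
for `t ≠ 0` its sign is that of `P(r/t)` (`d` even), and for `t = 0` that of `P(∞)`. -/
def homEval (d : ℕ) (P : Polynomial ℤ) (r t : ℤ) : ℤ :=
  ∑ j ∈ Finset.range (d + 1), P.coeff j * r ^ j * t ^ (d - j)

/-- The weight `d` action `(P|γ)(X) = (tX+u)^d P((rX+s)/(tX+u))` on integral polynomials
of degree at most `d`, for `γ = [[r,s],[t,u]]`. -/
def pslash (d : ℕ) (M : Mat2) (P : Polynomial ℤ) : Polynomial ℤ :=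
  ∑ j ∈ Finset.range (d + 1),
    C (P.coeff j) * (C (M 0 0) * X + C (M 0 1)) ^ j * (C (M 1 0) * X + C (M 1 1)) ^ (d - j)

/-- `P` has exactly two real roots `w ≠ w'`, both irrational. -/
def HasTwoIrratRoots (P : Polynomial ℤ) (w w' : ℝ) : Prop :=
  w ≠ w' ∧ Irrational w ∧ Irrational w' ∧ ∀ y : ℝ, Polynomial.aeval y P = 0 ↔ y = w ∨ y = w'

/-- `F_d`: integral polynomials of degree ≤ d with exactly two real roots, both irrational. -/
def Fd (d : ℕ) : Set (Polynomial ℤ) :=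
  {P | P.natDegree ≤ d ∧ ∃ w w' : ℝ, HasTwoIrratRoots P w w'}

/-- `A` is a `Γ`-equivalence class in `F_d`, where `Γ = PGL₂(ℤ)`. -/
def IsClassF (d : ℕ) (A : Set (Polynomial ℤ)) : Prop :=
  ∃ P₀ ∈ Fd d, A = {P ∈ Fd d | ∃ M : Mat2, IsUnit M.det ∧ P = pslash d M P₀}

/-- `B` is a `Γ₁`-equivalence class in `F_d`, where `Γ₁ = PSL₂(ℤ)`. -/
def IsClassF1 (d : ℕ) (B : Set (Polynomial ℤ)) : Prop :=
  ∃ P₀ ∈ Fd d, B = {P ∈ Fd d | ∃ M : Mat2, M.det = 1 ∧ P = pslash d M P₀}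

/-- `A^Sim = {P ∈ A : P(0) < 0 < P(∞)}`, where `P(∞)` is the coefficient of `X^d`. -/
def PSim (d : ℕ) (A : Set (Polynomial ℤ)) : Set (Polynomial ℤ) :=
  {P ∈ A | P.coeff 0 < 0 ∧ 0 < P.coeff d}

/-- `A^Red = {P ∈ A : P(∞) > 0 and P(-1) < 0 < P(0)}`. -/
def PRed (d : ℕ) (A : Set (Polynomial ℤ)) : Set (Polynomial ℤ) :=
  {P ∈ A | 0 < P.coeff d ∧ Polynomial.aeval (-1 : ℤ) P < 0 ∧ 0 < P.coeff 0}

/-- `A⟨x⟩ = {P ∈ A : P(∞) < 0 < P(x)}`. -/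
def Px (d : ℕ) (A : Set (Polynomial ℤ)) (x : ℝ) : Set (Polynomial ℤ) :=
  {P ∈ A | P.coeff d < 0 ∧ 0 < Polynomial.aeval x P}

/-- The numerators of the convergents, shifted by 2: `pconv x i = p_{i-2}`. -/
def pconv (x : ℝ) : ℕ → ℤ
  | 0 => 0
  | 1 => 1
  | i + 2 => cfN x i * pconv x (i + 1) + pconv x i

/-- The denominators of the convergents, shifted by 2: `qconv x i = q_{i-2}`. -/
def qconv (x : ℝ) : ℕ → ℤ
  | 0 => 1
  | 1 => 0
  | i + 2 => cfN x i * qconv x (i + 1) + qconv x i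

/-- `δ_i = (-1)^i (p_{i-1} - q_{i-1} x)` for `i ≥ 0`. -/
def cfDelta (x : ℝ) (i : ℕ) : ℝ :=
  (-1 : ℝ) ^ i * ((pconv x (i + 1) : ℝ) - (qconv x (i + 1) : ℝ) * x)

/-- The weight `d` action `(P|γ)(X) = (tX+u)^d P((rX+s)/(tX+u))` on complex polynomials
of degree at most `d`, for `γ = [[r,s],[t,u]]` with integer entries. -/
def cslash (d : ℕ) (M : Mat2) (P : Polynomial ℂ) : Polynomial ℂ :=
  ∑ j ∈ Finset.range (d + 1),
    C (P.coeff j) * (C (M 0 0 : ℂ) * X + C (M 0 1 : ℂ)) ^ j *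
      (C (M 1 0 : ℂ) * X + C (M 1 1 : ℂ)) ^ (d - j)

/-- `P^Γ(x) = ∑_{γ ∈ Γ(x)} (P|γ)(x)` for `P` of degree ≤ 2k. -/
def PGam (k : ℕ) (P : Polynomial ℂ) (x : ℝ) : ℂ :=
  ∑' γ : GammaSet x, Polynomial.eval (x : ℂ) (cslash (2 * k) γ.1 P)

/-- The homogenization of degree `d` of `P`, evaluated at `(a, b)`. -/
def hev {R : Type*} [CommRing R] (d : ℕ) (P : Polynomial ℤ) (a b : R) : R :=
  MvPolynomial.aeval ![a, b] (P.homogenize d)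

lemma hev_eq_sum {R : Type*} [CommRing R] (d : ℕ) (P : Polynomial ℤ) (a b : R) :
    hev d P a b = ∑ j ∈ Finset.range (d + 1), (P.coeff j : R) * a ^ j * b ^ (d - j) := by
  rw [hev, homogenize, map_sum, Finset.Nat.sum_antidiagonal_eq_sum_range_succ_mk]
  refine Finset.sum_congr rfl fun j _ => ?_
  rw [Finsupp.update_eq_add_single (by simp), MvPolynomial.aeval_monomial,
    Finsupp.prod_add_index' (by simp) (by simp [pow_add])]
  simp [mul_assoc]

lemma pslash_eq_hev (d : ℕ) (M : Mat2) (P : Polynomial ℤ) :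
    pslash d M P = hev d P (C (M 0 0) * X + C (M 0 1)) (C (M 1 0) * X + C (M 1 1)) := by
  simp [hev_eq_sum, pslash]

lemma homEval_eq_hev (d : ℕ) (P : Polynomial ℤ) (r t : ℤ) : homEval d P r t = hev d P r t := by
  simp [hev_eq_sum, homEval]

lemma homogenize_pslash (d : ℕ) (M : Mat2) (P : Polynomial ℤ) :
    (pslash d M P).homogenize d =
      hev d P (MvPolynomial.C (M 0 0) * MvPolynomial.X 0 + MvPolynomial.C (M 0 1) * MvPolynomial.X 1)
        (MvPolynomial.C (M 1 0) * MvPolynomial.X 0 + MvPolynomial.C (M 1 1) * MvPolynomial.X 1) := by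
  apply homogenize_eq_of_isHomogeneous
  · rw [hev, MvPolynomial.aeval_def]
    have hdeg := isHomogeneous_homogenize (n := d) P
    nth_rewrite 2 [← one_mul d]
    refine hdeg.eval₂ (algebraMap ℤ _) _ (fun c => ?_) fun i => ?_
    · rw [eq_intCast, ← eq_intCast MvPolynomial.C]
      exact MvPolynomial.isHomogeneous_C (Fin 2) c
    have h (c : ℤ) (k : Fin 2) :
        (MvPolynomial.C c * MvPolynomial.X k : MvPolynomial (Fin 2) ℤ).IsHomogeneous 1 := by
      simpa using (MvPolynomial.isHomogeneous_C (Fin 2) c).mul (MvPolynomial.isHomogeneous_X ℤ k)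
    fin_cases i
    · exact (h _ _).add (h _ _)
    · exact (h _ _).add (h _ _)
  · simp [hev_eq_sum, pslash_eq_hev]

lemma hev_pslash {R : Type*} [CommRing R] (d : ℕ) (M : Mat2) (P : Polynomial ℤ) (a b : R) :
    hev d (pslash d M P) a b = hev d P (M 0 0 * a + M 0 1 * b) (M 1 0 * a + M 1 1 * b) := by
  rw [hev, homogenize_pslash]
  simp [hev_eq_sum]

lemma pslash_pslash (d : ℕ) (M N : Mat2) (P : Polynomial ℤ) :
    pslash d N (pslash d M P) = pslash d (M * N) P := by
  rw [pslash_eq_hev, hev_pslash, pslash_eq_hev]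
  congr 1 <;> simp [Matrix.mul_apply, Fin.sum_univ_two] <;> ring

lemma hev_one_right {R : Type*} [CommRing R] {d : ℕ} {P : Polynomial ℤ} (hP : P.natDegree ≤ d)
    (y : R) : hev d P y 1 = aeval y P :=
  aeval_homogenize_of_eq_one hP _ rfl

lemma pslash_one {d : ℕ} {P : Polynomial ℤ} (hP : P.natDegree ≤ d) : pslash d 1 P = P := by
  simpa [pslash_eq_hev, hev_eq_sum] using
    (P.as_sum_range_C_mul_X_pow' (Nat.lt_succ_iff.2 hP)).symm

lemma hev_zero_right {R : Type*} [CommRing R] (d : ℕ) (P : Polynomial ℤ) (a : R) :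
    hev d P a 0 = P.coeff d * a ^ d := by
  rw [hev_eq_sum, Finset.sum_eq_single d]
  · simp
  · intro j hj hjd
    rw [zero_pow, mul_zero]
    have := Finset.mem_range.1 hj
    omega
  · simp

lemma hev_zero_left {R : Type*} [CommRing R] (d : ℕ) (P : Polynomial ℤ) (b : R) :
    hev d P 0 b = P.coeff 0 * b ^ d := by
  rw [hev_eq_sum, Finset.sum_eq_single 0]
  · simp
  · intro j _ hj
    simp [hj]
  · simp

lemma hev_eq_mul_aeval {d : ℕ} {P : Polynomial ℤ} (hP : P.natDegree ≤ d) (a b : ℝ) (hb : b ≠ 0) :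
    hev d P a b = b ^ d * aeval (a / b) P := by
  rw [← hev_one_right hP, hev_eq_sum, hev_eq_sum, Finset.mul_sum]
  refine Finset.sum_congr rfl fun j hj => ?_
  have hj : j ≤ d := Nat.lt_succ_iff.1 (Finset.mem_range.1 hj)
  rw [one_pow, mul_one, div_pow]
  nth_rewrite 2 [← Nat.sub_add_cancel hj]
  rw [pow_add]
  field_simp

lemma hev_intCast (d : ℕ) (P : Polynomial ℤ) (a b : ℤ) :
    ((hev d P a b : ℤ) : ℝ) = hev d P (a : ℝ) (b : ℝ) := by
  simp [hev_eq_sum]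

lemma natDegree_pslash_le (d : ℕ) (M : Mat2) (P : Polynomial ℤ) :
    (pslash d M P).natDegree ≤ d := by
  refine natDegree_sum_le_of_forall_le _ _ fun j hj => ?_
  have hj : j ≤ d := Nat.lt_succ_iff.1 (Finset.mem_range.1 hj)
  have h1 := natDegree_pow_le_of_le j (natDegree_linear_le (a := M 0 0) (b := M 0 1))
  have h2 := natDegree_pow_le_of_le (d - j)
    (natDegree_linear_le (a := M 1 0) (b := M 1 1))
  rw [mul_assoc]
  refine (natDegree_C_mul_le _ _).trans (natDegree_mul_le.trans ?_)
  omega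

lemma coeff_pslash_top (d : ℕ) (M : Mat2) (P : Polynomial ℤ) :
    (pslash d M P).coeff d = hev d P (M 0 0) (M 1 0) := by
  have h := hev_zero_right d (pslash d M P) (1 : ℤ)
  rw [hev_pslash] at h
  simpa using h.symm

lemma coeff_pslash_zero (d : ℕ) (M : Mat2) (P : Polynomial ℤ) :
    (pslash d M P).coeff 0 = hev d P (M 0 1) (M 1 1) := by
  have h := hev_zero_left d (pslash d M P) (1 : ℤ)
  rw [hev_pslash] at h
  simpa using h.symm

lemma eq_zero_of_irrational {y : ℝ} (hy : Irrational y) {a b : ℚ} (h : (a : ℝ) * y + b = 0) :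
    a = 0 ∧ b = 0 := by
  have ha : a = 0 := by
    by_contra ha
    refine hy ⟨-b / a, ?_⟩
    have : (a : ℝ) ≠ 0 := by exact_mod_cast ha
    push_cast
    field_simp
    linarith
  subst ha
  simpa using h

section Moebius

variable {M D : Mat2} {y : ℝ}

lemma moeb_denom_ne_zero (hM : M.det ≠ 0) (hy : Irrational y) :
    (M 1 0 : ℝ) * y + (M 1 1 : ℝ) ≠ 0 := by
  intro h
  obtain ⟨h1, h2⟩ := eq_zero_of_irrational hy (a := M 1 0) (b := M 1 1) (by exact_mod_cast h)
  norm_cast at h1 h2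
  simp [Matrix.det_fin_two, h1, h2] at hM

lemma irrational_moeb (hM : M.det ≠ 0) (hy : Irrational y) : Irrational (moeb M y) := by
  rintro ⟨q, hq⟩
  rw [moeb, eq_div_iff (moeb_denom_ne_zero hM hy)] at hq
  obtain ⟨h1, h2⟩ := eq_zero_of_irrational hy (a := M 0 0 - q * M 1 0) (b := M 0 1 - q * M 1 1)
    (by push_cast; linarith)
  apply hM
  rw [Matrix.det_fin_two]
  have : ((M 0 0 * M 1 1 - M 0 1 * M 1 0 : ℤ) : ℚ) = 0 := by
    push_cast
    linear_combination M 1 1 * h1 - M 1 0 * h2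
  exact_mod_cast this

lemma moeb_injOn (hM : M.det ≠ 0) : Set.InjOn (moeb M) {y | Irrational y} := by
  intro y hy z hz h
  have hdet : (M 0 0 * M 1 1 - M 0 1 * M 1 0 : ℝ) ≠ 0 := by
    rw [Matrix.det_fin_two] at hM
    exact_mod_cast hM
  rw [moeb, moeb, div_eq_div_iff (moeb_denom_ne_zero hM hy) (moeb_denom_ne_zero hM hz)] at h
  have h0 : (M 0 0 * M 1 1 - M 0 1 * M 1 0 : ℝ) * (y - z) = 0 := by linear_combination h
  linarith [(mul_eq_zero.1 h0).resolve_left hdet]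

lemma entries_of_mul_eq_one (h : M * D = 1) :
    M 0 0 * D 0 0 + M 0 1 * D 1 0 = 1 ∧ M 0 0 * D 0 1 + M 0 1 * D 1 1 = 0 ∧
      M 1 0 * D 0 0 + M 1 1 * D 1 0 = 0 ∧ M 1 0 * D 0 1 + M 1 1 * D 1 1 = 1 := by
  refine ⟨?_, ?_, ?_, ?_⟩
  · simpa [Matrix.mul_apply, Fin.sum_univ_two] using congrFun (congrFun h 0) 0
  · simpa [Matrix.mul_apply, Fin.sum_univ_two] using congrFun (congrFun h 0) 1
  · simpa [Matrix.mul_apply, Fin.sum_univ_two] using congrFun (congrFun h 1) 0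
  · simpa [Matrix.mul_apply, Fin.sum_univ_two] using congrFun (congrFun h 1) 1

lemma isUnit_det_of_mul_eq_one (h : M * D = 1) : IsUnit M.det :=
  IsUnit.of_mul_eq_one D.det (by rw [← Matrix.det_mul, h, Matrix.det_one])

lemma moeb_eq_of_mul_eq_one (h : M * D = 1) (hy : (D 1 0 : ℝ) * y + D 1 1 ≠ 0) :
    moeb M (moeb D y) = y := by
  obtain ⟨h1, h2, h3, h4⟩ := entries_of_mul_eq_one h
  have e1 : (M 0 0 * D 0 0 + M 0 1 * D 1 0 : ℝ) = 1 := by exact_mod_cast h1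
  have e2 : (M 0 0 * D 0 1 + M 0 1 * D 1 1 : ℝ) = 0 := by exact_mod_cast h2
  have e3 : (M 1 0 * D 0 0 + M 1 1 * D 1 0 : ℝ) = 0 := by exact_mod_cast h3
  have e4 : (M 1 0 * D 0 1 + M 1 1 * D 1 1 : ℝ) = 1 := by exact_mod_cast h4
  have n1 : (M 0 0 : ℝ) * moeb D y + M 0 1 = y / (D 1 0 * y + D 1 1) := by
    rw [moeb, eq_div_iff hy, add_mul, mul_assoc, div_mul_cancel₀ _ hy]
    linear_combination y * e1 + e2
  have n2 : (M 1 0 : ℝ) * moeb D y + M 1 1 = 1 / (D 1 0 * y + D 1 1) := by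
    rw [moeb, eq_div_iff hy, add_mul, mul_assoc, div_mul_cancel₀ _ hy]
    linear_combination y * e3 + e4
  rw [moeb, n1, n2, div_div_div_cancel_right₀ hy, div_one]

/-- If `D` is inverse to `M`, then the value of `P|D` at `M(y)` is, up to the automorphy factor,
the value of `P` at `y`. -/
lemma pow_mul_aeval_moeb_pslash {d : ℕ} {P : Polynomial ℤ} (hP : P.natDegree ≤ d)
    (h : D * M = 1) (hy : (M 1 0 : ℝ) * y + M 1 1 ≠ 0) :
    ((M 1 0 : ℝ) * y + M 1 1) ^ d * aeval (moeb M y) (pslash d D P) = aeval y P := by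
  rw [moeb, ← hev_eq_mul_aeval (natDegree_pslash_le d D P) _ _ hy, hev_pslash,
    ← hev_one_right hP]
  obtain ⟨h1, h2, h3, h4⟩ := entries_of_mul_eq_one h
  have e1 : (D 0 0 * M 0 0 + D 0 1 * M 1 0 : ℝ) = 1 := by exact_mod_cast h1
  have e2 : (D 0 0 * M 0 1 + D 0 1 * M 1 1 : ℝ) = 0 := by exact_mod_cast h2
  have e3 : (D 1 0 * M 0 0 + D 1 1 * M 1 0 : ℝ) = 0 := by exact_mod_cast h3
  have e4 : (D 1 0 * M 0 1 + D 1 1 * M 1 1 : ℝ) = 1 := by exact_mod_cast h4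
  congr 1
  · linear_combination y * e1 + e2
  · linear_combination y * e3 + e4

lemma pslash_mem_Fd {d : ℕ} {P : Polynomial ℤ} (hP : P ∈ Fd d) (hPd : P.coeff d ≠ 0)
    (h : D * M = 1) : pslash d D P ∈ Fd d := by
  obtain ⟨hdeg, w, w', hne, hw, hw', hroots⟩ := hP
  have h' : M * D = 1 := mul_eq_one_comm.1 h
  have hM : M.det ≠ 0 := (isUnit_det_of_mul_eq_one h').ne_zero
  have hroot (z : ℝ) (hz : Irrational z) (hPz : aeval z P = 0) :
      aeval (moeb M z) (pslash d D P) = 0 := by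
    have hden := moeb_denom_ne_zero hM hz
    have := pow_mul_aeval_moeb_pslash hdeg h hden
    rw [hPz] at this
    exact (mul_eq_zero.1 this).resolve_left (pow_ne_zero _ hden)
  refine ⟨natDegree_pslash_le d D P, moeb M w, moeb M w', fun he => hne (moeb_injOn hM hw hw' he),
    irrational_moeb hM hw, irrational_moeb hM hw', fun y => ⟨fun hy => ?_, ?_⟩⟩
  · rw [← hev_one_right (natDegree_pslash_le d D P), hev_pslash, mul_one, mul_one] at hy
    have hden : (D 1 0 : ℝ) * y + D 1 1 ≠ 0 := by
      intro h0
      rw [h0, hev_zero_right] at hy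
      have hnum : (D 0 0 : ℝ) * y + D 0 1 = 0 :=
        eq_zero_of_pow_eq_zero ((mul_eq_zero.1 hy).resolve_left (by exact_mod_cast hPd))
      obtain ⟨-, -, h3, h4⟩ := entries_of_mul_eq_one h'
      have e3 : (M 1 0 * D 0 0 + M 1 1 * D 1 0 : ℝ) = 0 := by exact_mod_cast h3
      have e4 : (M 1 0 * D 0 1 + M 1 1 * D 1 1 : ℝ) = 1 := by exact_mod_cast h4
      exact one_ne_zero (α := ℝ)
        (by linear_combination -e4 - y * e3 + M 1 0 * hnum + M 1 1 * h0)
    rw [hev_eq_mul_aeval hdeg _ _ hden] at hy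
    have hy := (hroots _).1 ((mul_eq_zero.1 hy).resolve_left (pow_ne_zero _ hden))
    have hinv := moeb_eq_of_mul_eq_one h' hden
    rw [moeb.eq_1 D] at hinv
    rcases hy with hy | hy
    · left; rw [← hinv, hy]
    · right; rw [← hinv, hy]
  · rintro (rfl | rfl)
    · exact hroot w hw ((hroots w).2 (Or.inl rfl))
    · exact hroot w' hw' ((hroots w').2 (Or.inr rfl))

end Moebius

/-- The inverse of `gam x i`, whose columns are consecutive convergents of `x`. -/
def convMat (x : ℝ) (i : ℕ) : Mat2 := !![pconv x (i + 1), pconv x i; qconv x (i + 1), qconv x i]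

lemma convMat_mul_gam (x : ℝ) (i : ℕ) : convMat x i * gam x i = 1 := by
  induction i with
  | zero => ext a b; fin_cases a <;> fin_cases b <;> simp [convMat, gam, pconv, qconv]
  | succ i ih =>
    rw [gam, ← mul_assoc]
    rw [show convMat x (i + 1) * (Meps * Tpow (-cfN x i)) = convMat x i by
      ext a b
      fin_cases a <;> fin_cases b <;>
        simp [convMat, pconv, qconv, Meps, Tpow, Matrix.mul_apply, Fin.sum_univ_two, mul_comm], ih]

section Convergents

variable {x : ℝ}

lemma irrational_cfX (hx : Irrational x) (i : ℕ) : Irrational (cfX x i) := by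
  induction i with
  | zero => exact hx
  | succ i ih =>
    rw [cfX, one_div]
    exact (ih.sub_intCast _).inv

lemma one_lt_cfX_succ (hx : Irrational x) (i : ℕ) : 1 < cfX x (i + 1) := by
  have h0 : 0 < cfX x i - ⌊cfX x i⌋ :=
    sub_pos.2 (lt_of_le_of_ne (Int.floor_le _) ((irrational_cfX hx i).ne_int _).symm)
  rw [cfX, lt_div_iff₀ h0]
  linarith [Int.lt_floor_add_one (cfX x i)]

lemma one_le_cfN_succ (hx : Irrational x) (i : ℕ) : 1 ≤ cfN x (i + 1) :=
  Int.le_floor.2 (by exact_mod_cast (one_lt_cfX_succ hx i).le)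

lemma qconv_add_le (hx : Irrational x) (i : ℕ) (h : 0 ≤ qconv x (i + 2)) :
    qconv x (i + 2) + qconv x (i + 1) ≤ qconv x (i + 3) := by
  have hrec : qconv x (i + 3) = cfN x (i + 1) * qconv x (i + 2) + qconv x (i + 1) := rfl
  rw [hrec]
  nlinarith [one_le_cfN_succ hx i]

lemma qconv_nonneg_and_pos (hx : Irrational x) (i : ℕ) :
    0 ≤ qconv x (i + 1) ∧ 0 < qconv x (i + 2) := by
  induction i with
  | zero => simp [qconv]
  | succ i ih =>
    have := qconv_add_le hx i ih.2.le
    exact ⟨ih.2.le, by linarith⟩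

lemma le_qconv (hx : Irrational x) (i : ℕ) : (i : ℤ) ≤ qconv x (i + 2) := by
  induction i with
  | zero => simp [qconv]
  | succ i ih =>
    rcases i with _ | i
    · have := (qconv_nonneg_and_pos hx 1).2
      push_cast
      linarith
    · have h1 := (qconv_nonneg_and_pos hx i).2
      have h2 := qconv_add_le hx (i + 1) (qconv_nonneg_and_pos hx (i + 1)).2.le
      push_cast at ih ⊢
      linarith

lemma cfX_eq (hx : Irrational x) (i : ℕ) :
    x * (qconv x (i + 1) * cfX x i + qconv x i) = pconv x (i + 1) * cfX x i + pconv x i := by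
  induction i with
  | zero => simp [qconv, pconv, cfX]
  | succ i ih =>
    have h0 : cfX x i - ⌊cfX x i⌋ ≠ 0 := sub_ne_zero.2 ((irrational_cfX hx i).ne_int _)
    rw [cfX]
    simp only [pconv, qconv, cfN]
    push_cast
    field_simp
    linear_combination ih

lemma abs_sub_convergent_le (hx : Irrational x) (i : ℕ) :
    |x - pconv x (i + 2) / qconv x (i + 2)| ≤ 1 / qconv x (i + 2) := by
  obtain ⟨h1, h2⟩ := qconv_nonneg_and_pos hx i
  have h1' : (0 : ℝ) ≤ qconv x (i + 1) := by exact_mod_cast h1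
  have h2' : (1 : ℝ) ≤ qconv x (i + 2) := by exact_mod_cast h2
  have hX := one_lt_cfX_succ hx i
  have hdet := Int.isUnit_iff_abs_eq.1 (isUnit_det_of_mul_eq_one (convMat_mul_gam x (i + 1)))
  have he := cfX_eq hx (i + 1)
  have hq : (1 : ℝ) ≤ qconv x (i + 2) * cfX x (i + 1) + qconv x (i + 1) := by nlinarith
  have habs : |x * qconv x (i + 2) - pconv x (i + 2)| *
      (qconv x (i + 2) * cfX x (i + 1) + qconv x (i + 1)) = 1 := by
    have hdet' : |((pconv x (i + 2) * qconv x (i + 1) - pconv x (i + 1) * qconv x (i + 2) : ℤ) : ℝ)|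
        = 1 := by
      rw [← Int.cast_abs]
      simp only [convMat, Matrix.det_fin_two_of] at hdet
      exact_mod_cast hdet
    rw [← hdet', ← abs_neg ((_ : ℤ) : ℝ)]
    conv_lhs => rw [← abs_of_pos (lt_of_lt_of_le one_pos hq), ← abs_mul]
    congr 1
    push_cast
    linear_combination (qconv x (i + 2) : ℝ) * he
  have hle : |x * qconv x (i + 2) - pconv x (i + 2)| ≤ 1 := by
    nlinarith [abs_nonneg (x * qconv x (i + 2) - pconv x (i + 2))]
  have hpos : (0 : ℝ) < qconv x (i + 2) := by linarith
  rw [sub_div' hpos.ne', abs_div, abs_of_pos hpos]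
  gcongr

lemma tendsto_convergent (hx : Irrational x) :
    Filter.Tendsto (fun i => (pconv x (i + 2) / qconv x (i + 2) : ℝ)) Filter.atTop (nhds x) := by
  rw [tendsto_iff_dist_tendsto_zero]
  refine squeeze_zero' (.of_forall fun _ => dist_nonneg) ?_ tendsto_one_div_atTop_nhds_zero_nat
  filter_upwards [Filter.eventually_gt_atTop 0] with i hi
  rw [dist_comm, Real.dist_eq]
  refine (abs_sub_convergent_le hx i).trans ?_
  have hi' : (0 : ℝ) < i := by exact_mod_cast hi
  gcongr
  exact_mod_cast le_qconv hx i

lemma exists_hev_convergent_pos {d : ℕ} {P : Polynomial ℤ} (hP : P.natDegree ≤ d)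
    (hx : Irrational x) (hPx : 0 < aeval x P) :
    ∃ i, 0 < hev d P (pconv x (i + 1)) (qconv x (i + 1)) := by
  have h := ((Polynomial.continuous_aeval P).tendsto x).comp (tendsto_convergent hx)
  obtain ⟨i, hi⟩ := (h.eventually (lt_mem_nhds hPx)).exists
  have hq : (0 : ℝ) < qconv x (i + 2) := by exact_mod_cast (qconv_nonneg_and_pos hx i).2
  refine ⟨i + 1, Int.cast_pos (R := ℝ).1 ?_⟩
  rw [hev_intCast, hev_eq_mul_aeval hP _ _ hq.ne']
  exact mul_pos (pow_pos hq d) hi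

lemma hev_convergent_ne_zero {d : ℕ} {P : Polynomial ℤ} (hP : P ∈ Fd d) (hPd : P.coeff d ≠ 0)
    (hx : Irrational x) (i : ℕ) : hev d P (pconv x (i + 1)) (qconv x (i + 1)) ≠ 0 := by
  obtain ⟨hdeg, w, w', -, hw, hw', hroots⟩ := hP
  rcases i with _ | i
  · simpa [pconv, qconv, hev_zero_right] using hPd
  have hq : (0 : ℝ) < qconv x (i + 2) := by exact_mod_cast (qconv_nonneg_and_pos hx i).2
  intro h0
  have h1 : hev d P (pconv x (i + 2) : ℝ) (qconv x (i + 2) : ℝ) = 0 := by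
    rw [← hev_intCast]
    exact_mod_cast h0
  rw [hev_eq_mul_aeval hdeg _ _ hq.ne'] at h1
  have hrat : ((pconv x (i + 2) / qconv x (i + 2) : ℚ) : ℝ) = pconv x (i + 2) / qconv x (i + 2) := by
    push_cast
    rfl
  rcases (hroots _).1 ((mul_eq_zero.1 h1).resolve_left (pow_ne_zero _ hq.ne')) with h | h
  · exact hw ⟨_, hrat.trans h⟩
  · exact hw' ⟨_, hrat.trans h⟩

end Convergents

/-- **Remark after Theorem 3.** For even `d > 0`, `A` a `Γ`-equivalence
class in `F_d` and `x` irrational, the map `(P,γ) ↦ P|γ` from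
`{(P,γ) ∈ A^Sim × Γ(x) : P(γ(∞)) < 0 < P(γ(x))}` to `A⟨x⟩` is surjective. -/
theorem stmt3 (d : ℕ) (hd : 0 < d) (hde : Even d) (A : Set (Polynomial ℤ))
    (hA : IsClassF d A) (x : ℝ) (hx : Irrational x) :
    Set.SurjOn (fun pg : Polynomial ℤ × Mat2 => pslash d pg.2 pg.1)
      {pg : Polynomial ℤ × Mat2 | pg.1 ∈ PSim d A ∧ pg.2 ∈ GammaSet x ∧
        homEval d pg.1 (pg.2 0 0) (pg.2 1 0) < 0 ∧
        0 < Polynomial.aeval (moeb pg.2 x) pg.1}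
      (Px d A x) := by
  intro P hP
  obtain ⟨hPA, hPd, hPx⟩ := hP
  obtain ⟨P₀, -, rfl⟩ := hA
  obtain ⟨hPF, M, hM, hPM⟩ := hPA
  have hdeg : P.natDegree ≤ d := hPF.1
  have hex := exists_hev_convergent_pos hdeg hx hPx
  classical
  obtain ⟨j, hj⟩ : ∃ j, Nat.find hex = j + 1 := by
    refine Nat.exists_eq_add_one_of_ne_zero fun h0 => ?_
    have h := Nat.find_spec hex
    simp only [h0, pconv, qconv, Int.cast_id, hev_zero_right, zero_add, one_pow, mul_one] at h
    exact hPd.not_gt h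
  have hpos := Nat.find_spec hex
  rw [hj] at hpos
  have hneg : hev d P (pconv x (j + 1)) (qconv x (j + 1)) < 0 :=
    lt_of_le_of_ne (not_lt.1 (Nat.find_min hex (by omega)))
      (hev_convergent_ne_zero hPF hPd.ne hx j)
  have hDg := convMat_mul_gam x (j + 1)
  have hden := moeb_denom_ne_zero
    (isUnit_det_of_mul_eq_one (mul_eq_one_comm.1 hDg)).ne_zero hx
  have hinv : pslash d (gam x (j + 1)) (pslash d (convMat x (j + 1)) P) = P := by
    rw [pslash_pslash, hDg, pslash_one hdeg]
  refine ⟨(pslash d (convMat x (j + 1)) P, gam x (j + 1)), ⟨⟨⟨pslash_mem_Fd hPF hPd.ne hDg,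
    M * convMat x (j + 1), ?_, ?_⟩, ?_, ?_⟩, ⟨j + 1, by omega, rfl⟩, ?_, ?_⟩, hinv⟩
  · rw [Matrix.det_mul]
    exact hM.mul (isUnit_det_of_mul_eq_one hDg)
  · rw [hPM, pslash_pslash]
  · rw [coeff_pslash_zero]
    exact hneg
  · rw [coeff_pslash_top]
    exact hpos
  · have h := coeff_pslash_top d (gam x (j + 1)) (pslash d (convMat x (j + 1)) P)
    rw [hinv] at h
    rw [homEval_eq_hev]
    exact h ▸ hPd
  · rw [← pow_mul_aeval_moeb_pslash hdeg hDg hden] at hPx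
    exact pos_of_mul_pos_right hPx (hde.pow_nonneg _)
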